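/- Let Ω ⊂ ℝ² be a bounded open set, let w : ℝ² → ℝ be smooth (C^∞) on a neighborhood of cl Ω, and let ψ : ℝ² → ℝ be smooth with compact support contained in Ω. Then the function t ↦ ∫_Ω ( −(w + tψ) ) det(D²(w + tψ)) dx is differentiable at t = 0 with derivative 3 ∫_Ω (−ψ) det(D²w) dx. -/

import Mathlib

open MeasureTheory

/-- The Hessian matrix of `u : ℝ² → ℝ` at `x`, whose `(i,j)` entry is `∂²u/∂xᵢ∂xⱼ (x)`. -/
noncomputable def hessian (u : EuclideanSpace ℝ (Fin 2) → ℝ)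
    (x : EuclideanSpace ℝ (Fin 2)) : Matrix (Fin 2) (Fin 2) ℝ :=
  Matrix.of fun i j =>
    fderiv ℝ (fun y => fderiv ℝ u y (EuclideanSpace.single j 1)) x (EuclideanSpace.single i 1)

open scoped ContDiff

/-- The partial derivative of `f : ℝ² → ℝ` in the `i`-th coordinate direction. -/
noncomputable def partialDeriv (i : Fin 2) (f : EuclideanSpace ℝ (Fin 2) → ℝ)
    (x : EuclideanSpace ℝ (Fin 2)) : ℝ :=
  fderiv ℝ f x (EuclideanSpace.single i 1)

section PartialDeriv

variable {f g : EuclideanSpace ℝ (Fin 2) → ℝ}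

theorem ContDiff.partialDeriv (hf : ContDiff ℝ ∞ f) (i : Fin 2) :
    ContDiff ℝ ∞ (partialDeriv i f) :=
  (hf.fderiv_right (m := ∞) le_rfl).clm_apply contDiff_const

theorem HasCompactSupport.partialDeriv (hf : HasCompactSupport f) (i : Fin 2) :
    HasCompactSupport (partialDeriv i f) :=
  hf.fderiv_apply ℝ _

theorem tsupport_partialDeriv_subset (f : EuclideanSpace ℝ (Fin 2) → ℝ) (i : Fin 2) :
    tsupport (partialDeriv i f) ⊆ tsupport f :=
  tsupport_fderiv_apply_subset ℝ _

theorem ContDiff.differentiableAt_of_smooth (hf : ContDiff ℝ ∞ f)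
    (x : EuclideanSpace ℝ (Fin 2)) : DifferentiableAt ℝ f x :=
  (hf.differentiable (by simp)).differentiableAt

theorem partialDeriv_mul (hf : ContDiff ℝ ∞ f) (hg : ContDiff ℝ ∞ g) (i : Fin 2)
    (x : EuclideanSpace ℝ (Fin 2)) :
    partialDeriv i (fun y => f y * g y) x
      = f x * partialDeriv i g x + g x * partialDeriv i f x := by
  simp [partialDeriv, fderiv_fun_mul (hf.differentiableAt_of_smooth x)
    (hg.differentiableAt_of_smooth x)]

theorem partialDeriv_sub (hf : ContDiff ℝ ∞ f) (hg : ContDiff ℝ ∞ g) (i : Fin 2)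
    (x : EuclideanSpace ℝ (Fin 2)) :
    partialDeriv i (fun y => f y - g y) x = partialDeriv i f x - partialDeriv i g x := by
  simp [partialDeriv, fderiv_fun_sub (hf.differentiableAt_of_smooth x)
    (hg.differentiableAt_of_smooth x)]

theorem partialDeriv_add_const_mul (hf : ContDiff ℝ ∞ f) (hg : ContDiff ℝ ∞ g) (t : ℝ)
    (i : Fin 2) :
    partialDeriv i (fun y => f y + t * g y)
      = fun x => partialDeriv i f x + t * partialDeriv i g x := by
  ext x
  simp [partialDeriv, fderiv_fun_add (hf.differentiableAt_of_smooth x)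
    ((hg.differentiableAt_of_smooth x).const_mul t),
    fderiv_const_mul (hg.differentiableAt_of_smooth x)]

theorem partialDeriv_comm (hf : ContDiff ℝ ∞ f) (i j : Fin 2) :
    partialDeriv i (partialDeriv j f) = partialDeriv j (partialDeriv i f) := by
  ext x
  have hd : DifferentiableAt ℝ (fderiv ℝ f) x :=
    ((hf.fderiv_right (m := ∞) le_rfl).differentiable (by simp)).differentiableAt
  have hsymm : IsSymmSndFDerivAt ℝ f x :=
    (hf.of_le (m := 2) (WithTop.coe_le_coe.2 le_top)).contDiffAt.isSymmSndFDerivAt (by simp)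
  have key (k l : Fin 2) : partialDeriv k (partialDeriv l f) x
      = fderiv ℝ (fderiv ℝ f) x (EuclideanSpace.single k 1) (EuclideanSpace.single l 1) := by
    unfold partialDeriv
    rw [fderiv_clm_apply hd (differentiableAt_const _)]
    simp
  rw [key, key, hsymm]

theorem integral_partialDeriv_eq_zero (hf : ContDiff ℝ ∞ f) (hfc : HasCompactSupport f)
    (i : Fin 2) : ∫ x, partialDeriv i f x = 0 := by
  have hi : Integrable f := hf.continuous.integrable_of_hasCompactSupport hfc
  have hi' : Integrable (partialDeriv i f) :=
    (hf.partialDeriv i).continuous.integrable_of_hasCompactSupport (hfc.partialDeriv i)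
  have h := integral_mul_fderiv_eq_neg_fderiv_mul_of_integrable (μ := volume)
    (f := fun _ : EuclideanSpace ℝ (Fin 2) => (1 : ℝ)) (g := f)
    (v := EuclideanSpace.single i 1) (by simp) (by simp only [one_mul]; exact hi')
    (by simpa using hi)
    (fun _ _ => differentiableAt_const _) (fun x _ => hf.differentiableAt_of_smooth x)
  simpa [partialDeriv] using h

end PartialDeriv

theorem hessian_apply (u : EuclideanSpace ℝ (Fin 2) → ℝ) (x : EuclideanSpace ℝ (Fin 2))
    (i j : Fin 2) : hessian u x i j = partialDeriv i (partialDeriv j u) x := rfl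

theorem Filter.EventuallyEq.hessian_eq {u v : EuclideanSpace ℝ (Fin 2) → ℝ}
    {x : EuclideanSpace ℝ (Fin 2)} (h : u =ᶠ[nhds x] v) : hessian u x = hessian v x := by
  ext i j
  have h' : (fun y => fderiv ℝ u y (EuclideanSpace.single j 1))
      =ᶠ[nhds x] fun y => fderiv ℝ v y (EuclideanSpace.single j 1) :=
    (h.fderiv (𝕜 := ℝ)).mono fun y hy => by simp only [hy]
  exact congrArg (fun L : EuclideanSpace ℝ (Fin 2) →L[ℝ] ℝ => L (EuclideanSpace.single i 1)) h'.fderiv_eq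

theorem hessian_add_const_mul {u v : EuclideanSpace ℝ (Fin 2) → ℝ} (hu : ContDiff ℝ ∞ u)
    (hv : ContDiff ℝ ∞ v) (t : ℝ) (x : EuclideanSpace ℝ (Fin 2)) :
    hessian (fun y => u y + t * v y) x = hessian u x + t • hessian v x := by
  ext i j
  simp only [hessian_apply, Matrix.add_apply, Matrix.smul_apply, smul_eq_mul]
  rw [partialDeriv_add_const_mul hu hv,
    partialDeriv_add_const_mul (hu.partialDeriv j) (hv.partialDeriv j)]

/-- The polarization of the determinant of the Hessian, `cof (D²u) : D²v`. -/
noncomputable def mixedHessianDet (u v : EuclideanSpace ℝ (Fin 2) → ℝ)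
    (x : EuclideanSpace ℝ (Fin 2)) : ℝ :=
  hessian u x 0 0 * hessian v x 1 1 + hessian u x 1 1 * hessian v x 0 0
    - hessian u x 0 1 * hessian v x 1 0 - hessian u x 1 0 * hessian v x 0 1

theorem mixedHessianDet_self (u : EuclideanSpace ℝ (Fin 2) → ℝ)
    (x : EuclideanSpace ℝ (Fin 2)) : mixedHessianDet u u x = 2 * (hessian u x).det := by
  rw [mixedHessianDet, Matrix.det_fin_two]
  ring

theorem det_hessian_add_const_mul {u v : EuclideanSpace ℝ (Fin 2) → ℝ} (hu : ContDiff ℝ ∞ u)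
    (hv : ContDiff ℝ ∞ v) (t : ℝ) (x : EuclideanSpace ℝ (Fin 2)) :
    (hessian (fun y => u y + t * v y) x).det
      = (hessian u x).det + t * mixedHessianDet u v x + t ^ 2 * (hessian v x).det := by
  rw [hessian_add_const_mul hu hv, mixedHessianDet]
  simp only [Matrix.det_fin_two, Matrix.add_apply, Matrix.smul_apply, smul_eq_mul]
  ring

theorem continuous_hessian_apply {u : EuclideanSpace ℝ (Fin 2) → ℝ} (hu : ContDiff ℝ ∞ u)
    (i j : Fin 2) : Continuous fun x => hessian u x i j :=
  ((hu.partialDeriv j).partialDeriv i).continuous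

theorem continuous_det_hessian {u : EuclideanSpace ℝ (Fin 2) → ℝ} (hu : ContDiff ℝ ∞ u) :
    Continuous fun x => (hessian u x).det := by
  have := continuous_hessian_apply hu
  simp only [Matrix.det_fin_two]
  fun_prop

theorem continuous_mixedHessianDet {u v : EuclideanSpace ℝ (Fin 2) → ℝ}
    (hu : ContDiff ℝ ∞ u) (hv : ContDiff ℝ ∞ v) : Continuous (mixedHessianDet u v) := by
  have := continuous_hessian_apply hu
  have := continuous_hessian_apply hv
  unfold mixedHessianDet
  fun_prop

theorem hessian_eq_zero_of_notMem_tsupport {u : EuclideanSpace ℝ (Fin 2) → ℝ}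
    {x : EuclideanSpace ℝ (Fin 2)} (hx : x ∉ tsupport u) : hessian u x = 0 := by
  ext i j
  rw [hessian_apply]
  exact image_eq_zero_of_notMem_tsupport fun h =>
    hx (tsupport_partialDeriv_subset u j (tsupport_partialDeriv_subset _ i h))

/-- The operator `v ↦ cof (D²s) : D²v` is formally self-adjoint. -/
theorem integral_mul_mixedHessianDet_comm {u v s : EuclideanSpace ℝ (Fin 2) → ℝ}
    (hu : ContDiff ℝ ∞ u) (hv : ContDiff ℝ ∞ v) (hs : ContDiff ℝ ∞ s)
    (huc : HasCompactSupport u) (hvc : HasCompactSupport v) :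
    ∫ x, u x * mixedHessianDet s v x = ∫ x, v x * mixedHessianDet s u x := by
  have integrable_of {f g : EuclideanSpace ℝ (Fin 2) → ℝ} (hf : Continuous f)
      (hg : Continuous g) (hfc : HasCompactSupport f) : Integrable fun x => f x * g x :=
    (hf.mul hg).integrable_of_hasCompactSupport hfc.mul_right
  rw [← sub_eq_zero, ← integral_sub
    (integrable_of hu.continuous (continuous_mixedHessianDet hs hv) huc)
    (integrable_of hv.continuous (continuous_mixedHessianDet hs hu) hvc)]
  set G : Fin 2 → EuclideanSpace ℝ (Fin 2) → ℝ := fun i x =>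
    u x * partialDeriv i v x - v x * partialDeriv i u x with hG
  have hGs (i : Fin 2) : ContDiff ℝ ∞ (G i) :=
    (hu.mul (hv.partialDeriv i)).sub (hv.mul (hu.partialDeriv i))
  have hGc (i : Fin 2) : HasCompactSupport (G i) :=
    (huc.mul_right (f' := partialDeriv i v)).sub (hvc.mul_right (f' := partialDeriv i u))
  have hGd (i j : Fin 2) (x : EuclideanSpace ℝ (Fin 2)) : partialDeriv j (G i) x
      = (u x * partialDeriv j (partialDeriv i v) x + partialDeriv i v x * partialDeriv j u x)
        - (v x * partialDeriv j (partialDeriv i u) x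
          + partialDeriv i u x * partialDeriv j v x) := by
    rw [hG, partialDeriv_sub (hu.mul (hv.partialDeriv i)) (hv.mul (hu.partialDeriv i)),
      partialDeriv_mul hu (hv.partialDeriv i), partialDeriv_mul hv (hu.partialDeriv i)]
  have hss (i j : Fin 2) : ContDiff ℝ ∞ (partialDeriv i (partialDeriv j s)) :=
    (hs.partialDeriv j).partialDeriv i
  set F : Fin 2 → Fin 2 → EuclideanSpace ℝ (Fin 2) → ℝ := fun i j x =>
    G i x * partialDeriv j (partialDeriv j s) x - G j x * partialDeriv i (partialDeriv j s) x
    with hF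
  have hFs (i j : Fin 2) : ContDiff ℝ ∞ (F i j) :=
    ((hGs i).mul (hss j j)).sub ((hGs j).mul (hss i j))
  have hFc (i j : Fin 2) : HasCompactSupport (F i j) :=
    ((hGc i).mul_right (f' := partialDeriv j (partialDeriv j s))).sub
      ((hGc j).mul_right (f' := partialDeriv i (partialDeriv j s)))
  have hFd (i j k : Fin 2) (x : EuclideanSpace ℝ (Fin 2)) : partialDeriv k (F i j) x
      = (G i x * partialDeriv k (partialDeriv j (partialDeriv j s)) x
          + partialDeriv j (partialDeriv j s) x * partialDeriv k (G i) x)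
        - (G j x * partialDeriv k (partialDeriv i (partialDeriv j s)) x
          + partialDeriv i (partialDeriv j s) x * partialDeriv k (G j) x) := by
    rw [hF, partialDeriv_sub ((hGs i).mul (hss j j)) ((hGs j).mul (hss i j)),
      partialDeriv_mul (hGs i) (hss j j), partialDeriv_mul (hGs j) (hss i j)]
  have hFi (i j k : Fin 2) : Integrable (partialDeriv k (F i j)) :=
    ((hFs i j).partialDeriv k).continuous.integrable_of_hasCompactSupport
      ((hFc i j).partialDeriv k)
  have hdiv (x : EuclideanSpace ℝ (Fin 2)) :
      u x * mixedHessianDet s v x - v x * mixedHessianDet s u x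
        = partialDeriv 0 (F 0 1) x + partialDeriv 1 (F 1 0) x := by
    simp only [hFd, hGd, mixedHessianDet, hessian_apply]
    rw [partialDeriv_comm hs 1 0, partialDeriv_comm hu 1 0, partialDeriv_comm hv 1 0,
      partialDeriv_comm (hs.partialDeriv 1) 1 0, partialDeriv_comm (hs.partialDeriv 0) 1 0,
      partialDeriv_comm hs 1 0]
    simp only [hG]
    ring
  simp only [hdiv]
  rw [integral_add (hFi 0 1 0) (hFi 1 0 1), integral_partialDeriv_eq_zero (hFs 0 1) (hFc 0 1),
    integral_partialDeriv_eq_zero (hFs 1 0) (hFc 1 0), add_zero]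

/-- A function smooth on a neighbourhood of a compact set `K` agrees near `K` with a smooth
compactly supported function. -/
theorem exists_contDiff_hasCompactSupport_eventuallyEq {E : Type*} [NormedAddCommGroup E]
    [NormedSpace ℝ E] [FiniteDimensional ℝ E] {K V : Set E} (hK : IsCompact K) (hV : IsOpen V)
    (hKV : K ⊆ V) {w : E → ℝ} (hw : ContDiffOn ℝ ∞ w V) :
    ∃ u : E → ℝ, ContDiff ℝ ∞ u ∧ HasCompactSupport u ∧ ∀ x ∈ K, w =ᶠ[nhds x] u := by
  obtain ⟨L, hL, hKL, hLV⟩ := exists_compact_between hK hV hKV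
  obtain ⟨χ, hχ1, hχ0, -⟩ := exists_contMDiffMap_one_nhds_of_subset_interior
    (n := ⊤) (modelWithCornersSelf ℝ E) hK.isClosed hKL
  have hχL : tsupport χ ⊆ L :=
    closure_minimal (fun x hx => by_contra fun h => hx (hχ0 x h)) hL.isClosed
  have hsupp : tsupport (fun x => χ x * w x) ⊆ L :=
    (tsupport_mul_subset_left (f := χ) (g := w)).trans hχL
  refine ⟨fun x => χ x * w x, contDiff_iff_contDiffAt.2 fun x => ?_,
    hL.of_isClosed_subset (isClosed_tsupport _) hsupp, fun x hx => ?_⟩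
  · by_cases hx : x ∈ L
    · exact χ.contMDiff.contDiff.contDiffAt.mul (hw.contDiffAt (hV.mem_nhds (hLV hx)))
    · exact contDiffAt_const.congr_of_eventuallyEq
        (notMem_tsupport_iff_eventuallyEq.1 fun h => hx (hsupp h))
  · filter_upwards [eventually_nhdsSet_iff_forall.1 hχ1 x hx] with y hy
    simp [hy]

/-- The first variation formula for smooth compactly supported `u`. -/
theorem hasDerivAt_setIntegral_det_hessian {Ω : Set (EuclideanSpace ℝ (Fin 2))}
    {u ψ : EuclideanSpace ℝ (Fin 2) → ℝ} (hu : ContDiff ℝ ∞ u) (huc : HasCompactSupport u)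
    (hψ : ContDiff ℝ ∞ ψ) (hψc : HasCompactSupport ψ) (hψΩ : tsupport ψ ⊆ Ω) :
    HasDerivAt
      (fun t : ℝ => ∫ x in Ω, (-(u x + t * ψ x)) * (hessian (fun y => u y + t * ψ y) x).det)
      (3 * ∫ x in Ω, (-ψ x) * (hessian u x).det) 0 := by
  have integrable_of {f g : EuclideanSpace ℝ (Fin 2) → ℝ} (hf : Continuous f)
      (hg : Continuous g) (hfc : HasCompactSupport f) : Integrable fun x => f x * g x :=
    (hf.mul hg).integrable_of_hasCompactSupport hfc.mul_right
  have hA := continuous_det_hessian hu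
  have hB := continuous_det_hessian hψ
  have hC := continuous_mixedHessianDet hu hψ
  have i1 := integrable_of hu.continuous hA huc
  have i2 := integrable_of hu.continuous hC huc
  have i3 := integrable_of hu.continuous hB huc
  have j1 := integrable_of hψ.continuous hA hψc
  have j2 := integrable_of hψ.continuous hC hψc
  have j3 := integrable_of hψ.continuous hB hψc
  have hψ0 (x) (hx : x ∉ Ω) : ψ x * (hessian u x).det = 0 := by
    simp [image_eq_zero_of_notMem_tsupport fun h => hx (hψΩ h)]
  have hC0 (x) (hx : x ∉ Ω) : u x * mixedHessianDet u ψ x = 0 := by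
    simp [mixedHessianDet, hessian_eq_zero_of_notMem_tsupport fun h => hx (hψΩ h)]
  have hsymm : ∫ x in Ω, u x * mixedHessianDet u ψ x
      = 2 * ∫ x in Ω, ψ x * (hessian u x).det := by
    rw [setIntegral_eq_integral_of_forall_compl_eq_zero hC0,
      setIntegral_eq_integral_of_forall_compl_eq_zero hψ0,
      integral_mul_mixedHessianDet_comm hu hψ hu huc hψc, ← integral_const_mul]
    refine integral_congr_ae (Filter.Eventually.of_forall fun x => ?_)
    simp only [mixedHessianDet_self]
    ring
  set a := ∫ x in Ω, u x * (hessian u x).det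
  set b := ∫ x in Ω, ψ x * (hessian u x).det
  set c := ∫ x in Ω, (u x * (hessian ψ x).det + ψ x * mixedHessianDet u ψ x)
  set d := ∫ x in Ω, ψ x * (hessian ψ x).det
  have hpoly : (fun t : ℝ =>
      ∫ x in Ω, (-(u x + t * ψ x)) * (hessian (fun y => u y + t * ψ y) x).det)
      = fun t => -(a + t * (3 * b) + t ^ 2 * c + t ^ 3 * d) := by
    ext t
    have e1 : 3 * b = ∫ x in Ω, (u x * mixedHessianDet u ψ x + ψ x * (hessian u x).det) := by
      rw [integral_add i2.integrableOn j1.integrableOn, hsymm]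
      ring
    have k1 : Integrable (fun x => t * (u x * mixedHessianDet u ψ x + ψ x * (hessian u x).det))
        (volume.restrict Ω) := ((i2.add j1).const_mul t).integrableOn
    have k2 : Integrable (fun x => t ^ 2 *
        (u x * (hessian ψ x).det + ψ x * mixedHessianDet u ψ x)) (volume.restrict Ω) :=
      ((i3.add j2).const_mul (t ^ 2)).integrableOn
    rw [e1, ← integral_const_mul, ← integral_const_mul, ← integral_const_mul,
      ← integral_add i1.integrableOn k1, ← integral_add (Integrable.fun_add i1.integrableOn k1) k2,
      ← integral_add ((Integrable.fun_add i1.integrableOn k1).fun_add k2) (j3.const_mul (t ^ 3)).integrableOn,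
      ← integral_neg]
    refine integral_congr_ae (Filter.Eventually.of_forall fun x => ?_)
    simp only [det_hessian_add_const_mul hu hψ]
    ring
  have hb : 3 * ∫ x in Ω, (-ψ x) * (hessian u x).det = -(3 * b) := by
    simp only [neg_mul, integral_neg, mul_neg, b]
  rw [hpoly, hb]
  have hid := hasDerivAt_id' (0 : ℝ)
  refine ((((hid.mul_const (3 * b)).const_add a).fun_add
    ((hid.fun_pow 2).mul_const c)).fun_add ((hid.fun_pow 3).mul_const d)).fun_neg.congr_deriv ?_
  simp

/-- First-variation formula for the Monge–Ampère functional: if `Ω ⊆ ℝ²` is bounded and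
open, `w` is smooth on a neighborhood of `cl Ω`, and `ψ` is smooth with compact support
contained in `Ω`, then `t ↦ ∫_Ω (−(w + tψ)) det(D²(w + tψ)) dx` is differentiable at
`t = 0` with derivative `3 ∫_Ω (−ψ) det(D²w) dx`. -/
theorem first_variation_monge_ampere_functional
    (Ω : Set (EuclideanSpace ℝ (Fin 2))) (hΩo : IsOpen Ω) (hΩb : Bornology.IsBounded Ω)
    (V : Set (EuclideanSpace ℝ (Fin 2))) (hVo : IsOpen V) (hV : closure Ω ⊆ V)
    (w : EuclideanSpace ℝ (Fin 2) → ℝ) (hw : ContDiffOn ℝ (⊤ : ℕ∞) w V)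
    (ψ : EuclideanSpace ℝ (Fin 2) → ℝ) (hψ : ContDiff ℝ (⊤ : ℕ∞) ψ)
    (hψc : HasCompactSupport ψ) (hψΩ : tsupport ψ ⊆ Ω) :
    HasDerivAt
      (fun t : ℝ => ∫ x in Ω, (-(w x + t * ψ x)) * (hessian (fun y => w y + t * ψ y) x).det)
      (3 * ∫ x in Ω, (-ψ x) * (hessian w x).det) 0 := by
  obtain ⟨u, hu, huc, hwu⟩ := exists_contDiff_hasCompactSupport_eventuallyEq
    hΩb.isCompact_closure hVo hV hw
  have hloc (x) (hx : x ∈ Ω) : w =ᶠ[nhds x] u := hwu x (subset_closure hx)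
  have hfun : (fun t : ℝ =>
      ∫ x in Ω, (-(w x + t * ψ x)) * (hessian (fun y => w y + t * ψ y) x).det)
      = fun t => ∫ x in Ω, (-(u x + t * ψ x)) * (hessian (fun y => u y + t * ψ y) x).det := by
    ext t
    refine setIntegral_congr_fun hΩo.measurableSet fun x hx => ?_
    have h : (fun y => w y + t * ψ y) =ᶠ[nhds x] fun y => u y + t * ψ y :=
      (hloc x hx).mono fun y hy => by simp only [hy]
    simp only [h.hessian_eq, (hloc x hx).eq_of_nhds]
  have hval : ∫ x in Ω, (-ψ x) * (hessian w x).det = ∫ x in Ω, (-ψ x) * (hessian u x).det :=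
    setIntegral_congr_fun hΩo.measurableSet fun x hx => by
      simp only [(hloc x hx).hessian_eq]
  rw [hfun, hval]
  exact hasDerivAt_setIntegral_det_hessian hu huc hψ hψc hψΩ
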